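/- arXiv:2406.03942 — 2 statements merged into one kernel-verified Lean document; each statement's English description precedes it below -/
import Mathlib

section
/- Let S be a finite generalized quadrangle of order (s,t) with s,t ≥ 1, and let Ω be its set of flags. For every pair of flags (x,y) ∈ R_1 one has N_{45}(x,y) = 0 while N_{54}(x,y) = st; in particular, since st ≥ 1, the association scheme on Ω is not commutative. -/
section Defs

variable {P L : Type*}

/-- Two distinct points are collinear if some line is incident with both. -/
def Collin (I : P → L → Prop) (p q : P) : Prop :=
  p ≠ q ∧ ∃ N : L, I p N ∧ I q N

/-- A finite generalized quadrangle of order `(s,t)` with point set `P`,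
line set `L` and incidence relation `I`. -/
structure IsGQ (s t : ℕ) (P L : Type*) (I : P → L → Prop) : Prop where
  nonemptyP : Nonempty P
  nonemptyL : Nonempty L
  finP : Finite P
  finL : Finite L
  lines_through : ∀ p : P, Nat.card {l : L // I p l} = t + 1
  points_on : ∀ l : L, Nat.card {p : P // I p l} = s + 1
  unique_line : ∀ p q : P, p ≠ q → ∀ l m : L, I p l → I q l → I p m → I q m → l = m
  unique_point : ∀ l m : L, l ≠ m → ∀ p q : P, I p l → I p m → I q l → I q m → p = q
  gq3 : ∀ (p : P) (l : L), ¬ I p l →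
    ∃! qM : P × L, I p qM.2 ∧ I qM.1 qM.2 ∧ I qM.1 l

/-- The set of flags (incident point–line pairs). -/
def GQFlag (I : P → L → Prop) : Type _ := {x : P × L // I x.1 x.2}

/-- The relations `R_0, …, R_7` on the set of flags.  For a flag `x = (p,L)` and
a flag `y = (q,M)`:
`R_0`: the diagonal; `R_1`: `p = q`, `L ≠ M`; `R_2`: `L = M`, `p ≠ q`;
`R_3`: `p ≠ q`, `L ≠ M`, `q` incident with `L`;
`R_4`: `p ≠ q`, `L ≠ M`, `p` incident with `M`;
`R_5`: `p ≠ q` collinear on a line different from both `L` and `M`;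
`R_6`: `L ≠ M` meet in a point `r` with `r ≠ p`, `r ≠ q`;
`R_7`: `L` and `M` have no common point and `p`, `q` are not collinear. -/
def Rrel (I : P → L → Prop) : ℕ → GQFlag I → GQFlag I → Prop
  | 0 => fun x y => x = y
  | 1 => fun x y => x.1.1 = y.1.1 ∧ x.1.2 ≠ y.1.2
  | 2 => fun x y => x.1.2 = y.1.2 ∧ x.1.1 ≠ y.1.1
  | 3 => fun x y => x.1.1 ≠ y.1.1 ∧ x.1.2 ≠ y.1.2 ∧ I y.1.1 x.1.2
  | 4 => fun x y => x.1.1 ≠ y.1.1 ∧ x.1.2 ≠ y.1.2 ∧ I x.1.1 y.1.2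
  | 5 => fun x y => x.1.1 ≠ y.1.1 ∧ ∃ N : L, I x.1.1 N ∧ I y.1.1 N ∧ N ≠ x.1.2 ∧ N ≠ y.1.2
  | 6 => fun x y => x.1.2 ≠ y.1.2 ∧ ∃ r : P, I r x.1.2 ∧ I r y.1.2 ∧ r ≠ x.1.1 ∧ r ≠ y.1.1
  | 7 => fun x y => (∀ r : P, ¬ (I r x.1.2 ∧ I r y.1.2)) ∧ ¬ Collin I x.1.1 y.1.1
  | _ => fun _ _ => False

/-- `Ncount I i j x y` is the number of flags `z` with `(x,z) ∈ R_i` and `(z,y) ∈ R_j`. -/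
noncomputable def Ncount (I : P → L → Prop) (i j : ℕ) (x y : GQFlag I) : ℕ :=
  Nat.card {z : GQFlag I // Rrel I i x z ∧ Rrel I j z y}

/-- The fused relations `S_0 = R_0`, `S_1 = R_1 ∪ R_2`, `S_2 = R_3 ∪ R_4`,
`S_3 = R_5 ∪ R_6`, `S_4 = R_7`. -/
def Srel (I : P → L → Prop) : ℕ → GQFlag I → GQFlag I → Prop
  | 0 => fun x y => Rrel I 0 x y
  | 1 => fun x y => Rrel I 1 x y ∨ Rrel I 2 x y
  | 2 => fun x y => Rrel I 3 x y ∨ Rrel I 4 x y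
  | 3 => fun x y => Rrel I 5 x y ∨ Rrel I 6 x y
  | 4 => fun x y => Rrel I 7 x y
  | _ => fun _ _ => False

/-- `Mcount I i j x y` is the number of flags `z` with `(x,z) ∈ S_i` and `(z,y) ∈ S_j`. -/
noncomputable def Mcount (I : P → L → Prop) (i j : ℕ) (x y : GQFlag I) : ℕ :=
  Nat.card {z : GQFlag I // Srel I i x z ∧ Srel I j z y}

end Defs

/-- `C` is a maximal clique of the graph with adjacency relation `rel`. -/
def IsMaxClique {α : Type*} (rel : α → α → Prop) (C : Set α) : Prop :=
  (∀ y ∈ C, ∀ z ∈ C, y ≠ z → rel y z) ∧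
  ∀ D : Set α, C ⊆ D → (∀ y ∈ D, ∀ z ∈ D, y ≠ z → rel y z) → D = C

/-- The point-clique through `x`: `{x} ∪ {z | (x,z) ∈ R_1}`. -/
def PC {α : Type*} (rel : ℕ → α → α → Prop) (x : α) : Set α :=
  insert x {z | rel 1 x z}

/-- The line-clique through `x`: `{x} ∪ {z | (x,z) ∈ R_2}`. -/
def LC {α : Type*} (rel : ℕ → α → α → Prop) (x : α) : Set α :=
  insert x {z | rel 2 x z}

/-- Removing one element satisfying `p` from a type of `n + 1` such elements leaves `n`. -/
theorem Nat.card_subtype_and_ne {α : Type*} [Finite α] {p : α → Prop} {a : α} {n : ℕ}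
    (ha : p a) (h : Nat.card {b // p b} = n + 1) : Nat.card {b // p b ∧ b ≠ a} = n := by
  change Set.ncard {b | p b} = n + 1 at h
  change Set.ncard {b | p b ∧ b ≠ a} = n
  have hdiff : {b | p b ∧ b ≠ a} = {b | p b} \ {a} := rfl
  rw [hdiff, Set.ncard_sdiff_singleton_of_mem (show a ∈ {b | p b} from ha), h,
    Nat.add_sub_cancel]

section FlagCounts

variable {s t : ℕ} {P L : Type*} {I : P → L → Prop}

theorem IsGQ.ncount_four_five_eq_zero (h : IsGQ s t P L I) {x y : GQFlag I} (hxy : Rrel I 1 x y) :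
    Ncount I 4 5 x y = 0 := by
  have : IsEmpty {z : GQFlag I // Rrel I 4 x z ∧ Rrel I 5 z y} := by
    refine ⟨fun ⟨z, ⟨hne, _, hxz⟩, ⟨_, N, hzN, hyN, hNz, _⟩⟩ => hNz ?_⟩
    rw [← hxy.1] at hyN
    exact h.unique_line _ _ hne N z.1.2 hyN hzN hxz z.2
  exact Nat.card_of_isEmpty

theorem rrel_five_and_rrel_four_iff {x y : GQFlag I}
    (hxy : Rrel I 1 x y) (z : GQFlag I) :
    Rrel I 5 x z ∧ Rrel I 4 z y ↔ (I z.1.1 y.1.2 ∧ z.1.1 ≠ y.1.1) ∧ z.1.2 ≠ y.1.2 := by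
  obtain ⟨hp, hl⟩ := hxy
  constructor
  · rintro ⟨_, hne, hzl, hzy⟩
    exact ⟨⟨hzy, hne⟩, hzl⟩
  · rintro ⟨⟨hzy, hne⟩, hzl⟩
    exact ⟨⟨fun e => hne (e.symm.trans hp), y.1.2, hp ▸ y.2, hzy, hl.symm, hzl.symm⟩,
      hne, hzl, hzy⟩

/-- The flags counted by `N_{54}(x,y)` are obtained by choosing a point `q ≠ y.1.1` on the line of
`y` and then a line through `q` other than that of `y`. -/
def rrelFiveFourEquiv {x y : GQFlag I} (hxy : Rrel I 1 x y) :
    {z : GQFlag I // Rrel I 5 x z ∧ Rrel I 4 z y} ≃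
      Σ q : {q : P // I q y.1.2 ∧ q ≠ y.1.1}, {K : L // I q.1 K ∧ K ≠ y.1.2} where
  toFun z :=
    have hz := (rrel_five_and_rrel_four_iff hxy z.1).1 z.2
    ⟨⟨z.1.1.1, hz.1⟩, ⟨z.1.1.2, z.1.2, hz.2⟩⟩
  invFun w := ⟨⟨(w.1.1, w.2.1), w.2.2.1⟩,
    (rrel_five_and_rrel_four_iff hxy _).2 ⟨w.1.2, w.2.2.2⟩⟩
  left_inv _ := rfl
  right_inv _ := rfl

theorem IsGQ.ncount_five_four (h : IsGQ s t P L I) {x y : GQFlag I} (hxy : Rrel I 1 x y) :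
    Ncount I 5 4 x y = s * t := by
  have := h.finP
  have := h.finL
  have := Fintype.ofFinite {q : P // I q y.1.2 ∧ q ≠ y.1.1}
  have hpoints : Nat.card {q : P // I q y.1.2 ∧ q ≠ y.1.1} = s :=
    Nat.card_subtype_and_ne y.2 (h.points_on y.1.2)
  have hlines (q : {q : P // I q y.1.2 ∧ q ≠ y.1.1}) :
      Nat.card {K : L // I q.1 K ∧ K ≠ y.1.2} = t :=
    Nat.card_subtype_and_ne q.2.1 (h.lines_through q.1)
  rw [Ncount, Nat.card_congr (rrelFiveFourEquiv hxy), Nat.card_sigma]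
  simp only [hlines, Finset.sum_const, Finset.card_univ, smul_eq_mul]
  rw [← Nat.card_eq_fintype_card, hpoints]

end FlagCounts

/-- for `(x,y) ∈ R_1`, `N_{45}(x,y) = 0` while `N_{54}(x,y) = st`;
in particular (since `st ≥ 1`) the scheme is not commutative. -/
theorem stmt_6 {s t : ℕ} (hs : 1 ≤ s) (ht : 1 ≤ t)
    {P L : Type*} (I : P → L → Prop) (hGQ : IsGQ s t P L I) :
    ∀ x y : GQFlag I, Rrel I 1 x y →
      Ncount I 4 5 x y = 0 ∧
      Ncount I 5 4 x y = s * t ∧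
      Ncount I 4 5 x y ≠ Ncount I 5 4 x y := by
  intro x y hxy
  have h45 := hGQ.ncount_four_five_eq_zero hxy
  have h54 := hGQ.ncount_five_four hxy
  refine ⟨h45, h54, ?_⟩
  rw [h45, h54]
  exact (Nat.mul_pos hs ht).ne
end

section
/- Let S be a finite generalized quadrangle of order (s,s) with s ≥ 1, Ω its set of flags, and S_1 = R_1 ∪ R_2, S_2 = R_3 ∪ R_4, S_3 = R_5 ∪ R_6, S_4 = R_7. Writing M_{ij}(x,y) for the number of flags z with (x,z) ∈ S_i and (z,y) ∈ S_j: for every (x,y) ∈ S_1, M_{11}(x,y) = s−1 and M_{12}(x,y) = s; for every (x,y) ∈ S_2, M_{11}(x,y) = 1; for every (x,y) ∈ S_3, M_{12}(x,y) = 1, M_{13}(x,y) = s−1 and M_{14}(x,y) = s; for every (x,y) ∈ S_4, M_{13}(x,y) = 2. -/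
section GQ

variable {P L : Type*} {I : P → L → Prop} {s t : ℕ}

namespace IsGQ

theorem eq_or_eq (h : IsGQ s t P L I) {p q : P} {l m : L}
    (hpl : I p l) (hql : I q l) (hpm : I p m) (hqm : I q m) : p = q ∨ l = m :=
  or_iff_not_imp_left.2 fun hpq => h.unique_line p q hpq l m hpl hql hpm hqm

theorem exists_proj (h : IsGQ s t P L I) {p : P} {l : L} (hpl : ¬ I p l) :
    ∃ q m, I p m ∧ I q m ∧ I q l := by
  obtain ⟨⟨q, m⟩, hqm, -⟩ := h.gq3 p l hpl
  exact ⟨q, m, hqm⟩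

/-- A generalized quadrangle contains no triangles. -/
theorem proj_unique (h : IsGQ s t P L I) {p q q' : P} {l m m' : L} (hpl : ¬ I p l)
    (hpm : I p m) (hqm : I q m) (hql : I q l)
    (hpm' : I p m') (hqm' : I q' m') (hql' : I q' l) : q = q' ∧ m = m' :=
  Prod.ext_iff.1 ((h.gq3 p l hpl).unique (y₁ := (q, m)) (y₂ := (q', m'))
    ⟨hpm, hqm, hql⟩ ⟨hpm', hqm', hql'⟩)

end IsGQ

/-- The dual of a generalized quadrangle. -/
theorem IsGQ.flip (h : IsGQ s t P L I) : IsGQ t s L P (flip I) where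
  nonemptyP := h.nonemptyL
  nonemptyL := h.nonemptyP
  finP := h.finL
  finL := h.finP
  lines_through := h.points_on
  points_on := h.lines_through
  unique_line := h.unique_point
  unique_point := h.unique_line
  gq3 l p hpl := by
    obtain ⟨q, m, hpm, hqm, hql⟩ := h.exists_proj hpl
    refine ⟨(m, q), ⟨hql, hqm, hpm⟩, ?_⟩
    rintro ⟨m', q'⟩ ⟨hql', hqm', hpm'⟩
    obtain ⟨rfl, rfl⟩ := h.proj_unique hpl hpm hqm hql hpm' hqm' hql'
    rfl

/-- The fused relations are pairwise disjoint. -/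
theorem Srel_index_unique (h : IsGQ s t P L I) {i j : ℕ} {x y : GQFlag I}
    (hi : Srel I i x y) (hj : Srel I j x y) : i = j := by
  obtain ⟨⟨p, l⟩, hpl⟩ := x
  obtain ⟨⟨q, m⟩, hqm⟩ := y
  have U := @h.eq_or_eq
  have T := @h.proj_unique
  clear h
  match i, j with
  | 0, 0 | 1, 1 | 2, 2 | 3, 3 | 4, 4 => rfl
  | i + 5, _ => exact hi.elim
  | _, j + 5 => exact hj.elim
  | 0, 1 | 0, 2 | 0, 3 | 0, 4 | 1, 0 | 1, 2 | 1, 3 | 1, 4 | 2, 0 | 2, 1 | 2, 3 | 2, 4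
  | 3, 0 | 3, 1 | 3, 2 | 3, 4 | 4, 0 | 4, 1 | 4, 2 | 4, 3 =>
    simp only [Srel, Rrel, Collin] at hi hj hpl hqm
    grind

/-- `C` contains a flag at distance `k` from `y`, and all other members of `C` are at
distance `k + 1` from `y`. -/
def HasGate (I : P → L → Prop) (C : Set (GQFlag I)) (k : ℕ) (y : GQFlag I) : Prop :=
  ∃ z₀ ∈ C, Srel I k z₀ y ∧ ∀ z ∈ C, z ≠ z₀ → Srel I (k + 1) z y

/-- The flags sharing the point of `x`. -/
def pointPencil (x : GQFlag I) : Set (GQFlag I) := {z | z.1.1 = x.1.1}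

/-- The flags sharing the line of `x`. -/
def linePencil (x : GQFlag I) : Set (GQFlag I) := {z | z.1.2 = x.1.2}

theorem mem_pointPencil (x : GQFlag I) : x ∈ pointPencil x := rfl

theorem mem_linePencil (x : GQFlag I) : x ∈ linePencil x := rfl

theorem hasGate_pointPencil {k : ℕ} {y : GQFlag I} {p : P} {l N : L} {hpl : I p l} (hN : I p N)
    (h₀ : Srel I k ⟨(p, N), hN⟩ y)
    (h₁ : ∀ (N' : L) (hN' : I p N'), N' ≠ N → Srel I (k + 1) ⟨(p, N'), hN'⟩ y) :
    HasGate I (pointPencil ⟨(p, l), hpl⟩) k y := by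
  refine ⟨⟨(p, N), hN⟩, rfl, h₀, ?_⟩
  rintro ⟨⟨p', N'⟩, hN'⟩ (rfl : p' = p) hne
  refine h₁ N' hN' ?_
  rintro rfl
  exact hne rfl

theorem hasGate_linePencil {k : ℕ} {y : GQFlag I} {p r : P} {l : L} {hpl : I p l} (hr : I r l)
    (h₀ : Srel I k ⟨(r, l), hr⟩ y)
    (h₁ : ∀ (r' : P) (hr' : I r' l), r' ≠ r → Srel I (k + 1) ⟨(r', l), hr'⟩ y) :
    HasGate I (linePencil ⟨(p, l), hpl⟩) k y := by
  refine ⟨⟨(r, l), hr⟩, rfl, h₀, ?_⟩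
  rintro ⟨⟨r', l'⟩, hr'⟩ (rfl : l' = l) hne
  refine h₁ r' hr' ?_
  rintro rfl
  exact hne rfl

theorem Rrel_one_gates (h : IsGQ s t P L I) {x y : GQFlag I} (hxy : Rrel I 1 x y) :
    HasGate I (pointPencil x) 0 y ∧ HasGate I (linePencil x) 1 y := by
  obtain ⟨⟨p, l⟩, hpl⟩ := x
  obtain ⟨⟨q, m⟩, hqm⟩ := y
  have U := @h.eq_or_eq
  have T := @h.proj_unique
  clear h
  simp only [Rrel] at hxy hpl hqm
  refine ⟨hasGate_pointPencil (hxy.1 ▸ hqm : I p m) ?_ ?_, hasGate_linePencil hpl ?_ ?_⟩ <;>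
    simp only [Srel, Rrel] <;> grind

theorem Rrel_three_gates (h : IsGQ s t P L I) {x y : GQFlag I} (hxy : Rrel I 3 x y) :
    HasGate I (pointPencil x) 2 y ∧ HasGate I (linePencil x) 1 y := by
  obtain ⟨⟨p, l⟩, hpl⟩ := x
  obtain ⟨⟨q, m⟩, hqm⟩ := y
  have U := @h.eq_or_eq
  have T := @h.proj_unique
  clear h
  simp only [Rrel] at hxy hpl hqm
  refine ⟨hasGate_pointPencil hpl ?_ ?_, hasGate_linePencil hxy.2.2 ?_ ?_⟩ <;>
    simp only [Srel, Rrel] <;> grind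

theorem Rrel_five_gates (h : IsGQ s t P L I) {x y : GQFlag I} (hxy : Rrel I 5 x y) :
    HasGate I (pointPencil x) 2 y ∧ HasGate I (linePencil x) 3 y := by
  obtain ⟨⟨p, l⟩, hpl⟩ := x
  obtain ⟨⟨q, m⟩, hqm⟩ := y
  have U := @h.eq_or_eq
  have T := @h.proj_unique
  clear h
  simp only [Rrel] at hxy hpl hqm
  obtain ⟨hpq, N, hpN, hqN, hNl, hNm⟩ := hxy
  have hql : ¬ I q l := by grind
  have proj {r : P} {K : L} (hrl : I r l) (hrK : I r K) (hqK : I q K) : r = p ∧ K = N :=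
    T hql hqK hrK hrl hqN hpN hpl
  refine ⟨hasGate_pointPencil hpN ?_ ?_, hasGate_linePencil hpl ?_ fun r' hr' hne => ⟨?_, ?_⟩⟩
  · simp only [Srel, Rrel]
    grind
  · simp only [Srel, Rrel]
    grind
  · exact .inl ⟨hpq, N, hpN, hqN, hNl, hNm⟩
  · exact fun r hr => hNm (proj hr.1 hr.2 hqm).2.symm
  · exact fun ⟨_, K, hrK, hqK⟩ => hne (proj hr' hrK hqK).1

theorem Rrel_seven_gate (h : IsGQ s t P L I) {x y : GQFlag I} (hxy : Rrel I 7 x y) :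
    HasGate I (pointPencil x) 3 y := by
  obtain ⟨⟨p, l⟩, hpl⟩ := x
  obtain ⟨⟨q, m⟩, hqm⟩ := y
  obtain ⟨hlm, hpq⟩ := hxy
  have hpm : ¬ I p m := fun hpm => hlm p ⟨hpl, hpm⟩
  obtain ⟨r, N, hpN, hrN, hrm⟩ := h.exists_proj hpm
  refine hasGate_pointPencil hpN (.inr ⟨?_, r, hrN, hrm, ?_, ?_⟩) fun N' hN' hne => ⟨?_, hpq⟩
  · rintro rfl
    exact hpm hpN
  · rintro rfl
    exact hpm hrm
  · rintro rfl
    refine hpq ⟨?_, N, hpN, hrN⟩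
    rintro rfl
    exact hpm hrm
  · exact fun r' hr' => hne (h.proj_unique hpm hN' hr'.1 hr'.2 hpN hrN hrm).2

/-- The flag of the dual structure corresponding to a flag. -/
def GQFlag.dual (x : GQFlag I) : GQFlag (flip I) := ⟨x.1.swap, x.2⟩

theorem Rrel_dual_seven {x y : GQFlag I} :
    Rrel (flip I) 7 x.dual y.dual ↔ Rrel I 7 x y := by
  obtain ⟨⟨p, l⟩, hpl⟩ := x
  obtain ⟨⟨q, m⟩, hqm⟩ := y
  simp only [Rrel, GQFlag.dual, flip, Collin, Prod.swap] at *
  grind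

theorem Srel_dual (k : ℕ) {x y : GQFlag I} :
    Srel (flip I) k x.dual y.dual ↔ Srel I k x y := by
  match k with
  | 0 => exact ⟨congrArg (GQFlag.dual (I := flip I)), congrArg GQFlag.dual⟩
  | 1 => exact or_comm
  | 2 => simp only [Srel, Rrel, GQFlag.dual, Prod.swap, flip]; tauto
  | 3 => exact or_comm
  | 4 => exact Rrel_dual_seven
  | _ + 5 => exact Iff.rfl

theorem HasGate_dual {C : Set (GQFlag I)} {D : Set (GQFlag (flip I))} {k : ℕ} {y : GQFlag I}
    (hCD : ∀ z : GQFlag I, z.dual ∈ D ↔ z ∈ C) (hD : HasGate (flip I) D k y.dual) :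
    HasGate I C k y := by
  obtain ⟨z₀, hz₀, hk, hz⟩ := hD
  refine ⟨GQFlag.dual z₀, (hCD _).1 hz₀, (Srel_dual k).1 hk, fun z hzC hne => ?_⟩
  refine (Srel_dual (k + 1)).1 (hz _ ((hCD z).2 hzC) ?_)
  rintro rfl
  exact hne rfl

/-- At distance `1`, `2` or `3` exactly one of the two pencils of `x` comes closer to `y`. -/
theorem gates_of_Srel (h : IsGQ s t P L I) {i : ℕ} (hi : i < 3) {x y : GQFlag I}
    (hxy : Srel I (i + 1) x y) :
    HasGate I (pointPencil x) i y ∧ HasGate I (linePencil x) (i + 1) y ∨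
    HasGate I (pointPencil x) (i + 1) y ∧ HasGate I (linePencil x) i y := by
  have hp : ∀ z : GQFlag I, z.dual ∈ linePencil x.dual ↔ z ∈ pointPencil x := fun _ => Iff.rfl
  have hl : ∀ z : GQFlag I, z.dual ∈ pointPencil x.dual ↔ z ∈ linePencil x := fun _ => Iff.rfl
  have swap {k m : ℕ} (hd : HasGate (flip I) (pointPencil x.dual) k y.dual ∧
      HasGate (flip I) (linePencil x.dual) m y.dual) :
      HasGate I (pointPencil x) m y ∧ HasGate I (linePencil x) k y :=
    ⟨HasGate_dual hp hd.2, HasGate_dual hl hd.1⟩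
  interval_cases i
  · rcases hxy with hxy | hxy
    · exact .inl (Rrel_one_gates h hxy)
    · exact .inr (swap (Rrel_one_gates h.flip hxy))
  · rcases hxy with hxy | ⟨hpq, hlm, hpm⟩
    · exact .inr (Rrel_three_gates h hxy)
    · exact .inl (swap (Rrel_three_gates h.flip ⟨hlm, hpq, hpm⟩))
  · rcases hxy with hxy | hxy
    · exact .inl (Rrel_five_gates h hxy)
    · exact .inr (swap (Rrel_five_gates h.flip hxy))

theorem gates_of_Srel_four (h : IsGQ s t P L I) {x y : GQFlag I} (hxy : Srel I 4 x y) :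
    HasGate I (pointPencil x) 3 y ∧ HasGate I (linePencil x) 3 y :=
  ⟨Rrel_seven_gate h hxy, HasGate_dual (D := pointPencil x.dual) (fun _ => Iff.rfl)
    (Rrel_seven_gate h.flip (Rrel_dual_seven.2 hxy))⟩

theorem finite_GQFlag (h : IsGQ s t P L I) : Finite (GQFlag I) := by
  have := h.finP
  have := h.finL
  exact Subtype.finite

theorem ncard_pointPencil (h : IsGQ s t P L I) (x : GQFlag I) :
    (pointPencil x).ncard = t + 1 := by
  rw [← h.lines_through x.1.1, ← Nat.card_coe_set_eq]
  refine Nat.card_congr ⟨fun z => ⟨z.1.1.2, ?_⟩, fun l => ⟨⟨(x.1.1, l.1), l.2⟩, rfl⟩, ?_, ?_⟩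
  · have hz := z.1.2
    rwa [show z.1.1.1 = x.1.1 from z.2] at hz
  · exact fun z => Subtype.ext (Subtype.ext (Prod.ext z.2.symm rfl))
  · exact fun _ => rfl

theorem ncard_linePencil (h : IsGQ s t P L I) (x : GQFlag I) :
    (linePencil x).ncard = s + 1 := by
  rw [← h.points_on x.1.2, ← Nat.card_coe_set_eq]
  refine Nat.card_congr ⟨fun z => ⟨z.1.1.1, ?_⟩, fun p => ⟨⟨(p.1, x.1.2), p.2⟩, rfl⟩, ?_, ?_⟩
  · have hz := z.1.2
    rwa [show z.1.1.2 = x.1.2 from z.2] at hz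
  · exact fun z => Subtype.ext (Subtype.ext (Prod.ext rfl z.2.symm))
  · exact fun _ => rfl

/-- The members of `C` other than `x` at distance `j` from `y`. -/
def othersAt (I : P → L → Prop) (C : Set (GQFlag I)) (x y : GQFlag I) (j : ℕ) :
    Set (GQFlag I) := {z | (z ∈ C ∧ z ≠ x) ∧ Srel I j z y}

theorem Mcount_one_eq (h : IsGQ s t P L I) (j : ℕ) (x y : GQFlag I) :
    Mcount I 1 j x y =
      (othersAt I (pointPencil x) x y j).ncard + (othersAt I (linePencil x) x y j).ncard := by
  have := finite_GQFlag h
  rw [← Set.ncard_union_eq, Mcount, ← Nat.card_coe_set_eq]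
  · refine Nat.card_congr (Equiv.subtypeEquivRight fun z => ?_)
    obtain ⟨⟨p, l⟩, hpl⟩ := x
    obtain ⟨⟨q, m⟩, hqm⟩ := z
    simp only [Srel, Rrel, othersAt, pointPencil, linePencil, Set.mem_ofPred_eq]
    grind
  · rw [Set.disjoint_left]
    rintro z ⟨⟨hzp, hne⟩, -⟩ ⟨⟨hzl, -⟩, -⟩
    exact hne (Subtype.ext (Prod.ext hzp hzl))

theorem ncard_othersAt_of_gate_eq (h : IsGQ s t P L I) {C : Set (GQFlag I)} {x y : GQFlag I}
    {k n : ℕ} (hx : x ∈ C) (hC : C.ncard = n + 1) (hg : HasGate I C k y) (hxy : Srel I k x y)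
    (j : ℕ) : (othersAt I C x y j).ncard = if j = k + 1 then n else 0 := by
  have := finite_GQFlag h
  obtain ⟨z₀, hz₀, hk, hz⟩ := hg
  obtain rfl : x = z₀ := by
    by_contra hne
    exact absurd (Srel_index_unique h hxy (hz x hx hne)) (by omega)
  split_ifs with hj
  · subst hj
    have : othersAt I C x y (k + 1) = C \ {x} := by
      ext z
      exact ⟨fun hzC => hzC.1, fun hzC => ⟨hzC, hz z hzC.1 hzC.2⟩⟩
    rw [this, Set.ncard_sdiff_singleton_of_mem hx, hC, Nat.add_sub_cancel]
  · rw [Set.ncard_eq_zero, Set.eq_empty_iff_forall_notMem]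
    exact fun z hzC => hj (Srel_index_unique h hzC.2 (hz z hzC.1.1 hzC.1.2))

theorem ncard_othersAt_of_gate_lt (h : IsGQ s t P L I) {C : Set (GQFlag I)} {x y : GQFlag I}
    {k n : ℕ} (hx : x ∈ C) (hC : C.ncard = n + 1) (hg : HasGate I C k y)
    (hxy : Srel I (k + 1) x y) (j : ℕ) :
    (othersAt I C x y j).ncard = if j = k then 1 else if j = k + 1 then n - 1 else 0 := by
  have := finite_GQFlag h
  obtain ⟨z₀, hz₀, hk, hz⟩ := hg
  have hne : z₀ ≠ x := by
    rintro rfl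
    exact absurd (Srel_index_unique h hk hxy) (by omega)
  split_ifs with hj hj'
  · subst hj
    rw [Set.ncard_eq_one]
    refine ⟨z₀, Set.ext fun z => ⟨fun hzC => ?_, ?_⟩⟩
    · by_contra hzne
      exact absurd (Srel_index_unique h hzC.2 (hz z hzC.1.1 hzne)) (by omega)
    · rintro rfl
      exact ⟨⟨hz₀, hne⟩, hk⟩
  · subst hj'
    have : othersAt I C x y (k + 1) = (C \ {x}) \ {z₀} := by
      ext z
      refine ⟨fun hzC => ⟨hzC.1, ?_⟩, fun hzC => ⟨hzC.1, hz z hzC.1.1 hzC.2⟩⟩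
      rintro rfl
      exact hj (Srel_index_unique h hzC.2 hk)
    have hz₀' : z₀ ∈ C \ {x} := ⟨hz₀, hne⟩
    rw [this, Set.ncard_sdiff_singleton_of_mem hz₀', Set.ncard_sdiff_singleton_of_mem hx,
      hC, Nat.add_sub_cancel]
  · rw [Set.ncard_eq_zero, Set.eq_empty_iff_forall_notMem]
    intro z hzC
    by_cases hzz : z = z₀
    · subst hzz
      exact hj (Srel_index_unique h hzC.2 hk)
    · exact hj' (Srel_index_unique h hzC.2 (hz z hzC.1.1 hzz))

theorem Mcount_one_of_Srel (h : IsGQ s s P L I) {i : ℕ} (hi : i < 3) {x y : GQFlag I}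
    (hxy : Srel I (i + 1) x y) (j : ℕ) :
    Mcount I 1 j x y = (if j = i then 1 else if j = i + 1 then s - 1 else 0) +
      if j = i + 2 then s else 0 := by
  rw [Mcount_one_eq h]
  rcases gates_of_Srel h hi hxy with ⟨hp, hl⟩ | ⟨hp, hl⟩
  · rw [ncard_othersAt_of_gate_lt h (mem_pointPencil x) (ncard_pointPencil h x) hp hxy,
      ncard_othersAt_of_gate_eq h (mem_linePencil x) (ncard_linePencil h x) hl hxy]
  · rw [ncard_othersAt_of_gate_eq h (mem_pointPencil x) (ncard_pointPencil h x) hp hxy,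
      ncard_othersAt_of_gate_lt h (mem_linePencil x) (ncard_linePencil h x) hl hxy, add_comm]

end GQ

/-- some intersection numbers of the fusion scheme. -/
theorem stmt_15 {s : ℕ} (hs : 1 ≤ s)
    {P L : Type*} (I : P → L → Prop) (hGQ : IsGQ s s P L I) :
    (∀ x y : GQFlag I, Srel I 1 x y →
      Mcount I 1 1 x y = s - 1 ∧ Mcount I 1 2 x y = s) ∧
    (∀ x y : GQFlag I, Srel I 2 x y →
      Mcount I 1 1 x y = 1) ∧
    (∀ x y : GQFlag I, Srel I 3 x y →
      Mcount I 1 2 x y = 1 ∧ Mcount I 1 3 x y = s - 1 ∧ Mcount I 1 4 x y = s) ∧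
    (∀ x y : GQFlag I, Srel I 4 x y →
      Mcount I 1 3 x y = 2) := by
  refine ⟨fun x y hxy => ⟨?_, ?_⟩, fun x y hxy => ?_, fun x y hxy => ⟨?_, ?_, ?_⟩,
    fun x y hxy => ?_⟩
  · simpa using Mcount_one_of_Srel hGQ (i := 0) (by norm_num) hxy 1
  · simpa using Mcount_one_of_Srel hGQ (i := 0) (by norm_num) hxy 2
  · simpa using Mcount_one_of_Srel hGQ (i := 1) (by norm_num) hxy 1
  · simpa using Mcount_one_of_Srel hGQ (i := 2) (by norm_num) hxy 2
  · simpa using Mcount_one_of_Srel hGQ (i := 2) (by norm_num) hxy 3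
  · simpa using Mcount_one_of_Srel hGQ (i := 2) (by norm_num) hxy 4
  · obtain ⟨hp, hl⟩ := gates_of_Srel_four hGQ hxy
    rw [Mcount_one_eq hGQ,
      ncard_othersAt_of_gate_lt hGQ (mem_pointPencil x) (ncard_pointPencil hGQ x) hp hxy,
      ncard_othersAt_of_gate_lt hGQ (mem_linePencil x) (ncard_linePencil hGQ x) hl hxy]
    simp
end
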